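/- (Verblunsky.) Let μ be a nontrivial probability measure on the unit circle, and let μ_n be the Bernstein–Szegő measure dμ_n = dθ/(2π·|φ_n(e^{iθ}; dμ)|²). Then the Carathéodory function of μ_n is F(z, dμ_n) = ψ_n^*(z; dμ)/φ_n^*(z; dμ) for z ∈ 𝔻, where ψ_n are the second kind polynomials of μ. -/

import Mathlib

open MeasureTheory Polynomial Filter

noncomputable section

/-- A nontrivial probability measure on the unit circle: a probability measure on `ℂ`
supported on `{z : ‖z‖ = 1}` that is not concentrated on any finite set
(equivalently, its support is infinite). -/
structure IsNontrivialOnCircle (μ : Measure ℂ) : Prop where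
  prob : IsProbabilityMeasure μ
  onCircle : μ {z : ℂ | ‖z‖ = 1}ᶜ = 0
  infiniteSupport : ∀ s : Finset ℂ, μ ((↑s : Set ℂ)ᶜ) ≠ 0

/-- `Φ` is the family of monic orthogonal polynomials for `μ`: each `Φ n` is monic of
degree `n` and orthogonal in `L²(∂𝔻, dμ)` to `z^j` for `j = 0, …, n-1`. -/
def IsMonicOPUC (μ : Measure ℂ) (Φ : ℕ → Polynomial ℂ) : Prop :=
  ∀ n : ℕ, ((Φ n).Monic ∧ (Φ n).natDegree = n) ∧
    ∀ j < n, ∫ z, (starRingEnd ℂ) z ^ j * (Φ n).eval z ∂μ = 0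

/-- Verblunsky coefficients: `α n = -conj (Φ (n+1) (0))`. -/
def verblunsky (Φ : ℕ → Polynomial ℂ) (n : ℕ) : ℂ :=
  - (starRingEnd ℂ) ((Φ (n + 1)).eval 0)

/-- Squared `L²(dμ)` norm of a polynomial. -/
def polyNormSq (μ : Measure ℂ) (P : Polynomial ℂ) : ℝ :=
  ∫ z, ‖P.eval z‖ ^ 2 ∂μ

/-- Orthonormal polynomial: `φ = Φ / ‖Φ‖_{L²(dμ)}`. -/
def orthonormalize (μ : Measure ℂ) (P : Polynomial ℂ) : Polynomial ℂ :=
  Polynomial.C ((Real.sqrt (polyNormSq μ P) : ℂ))⁻¹ * P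

/-- The reversed polynomial `P^{*,n}(z) = z^n conj (P (1/conj z))`. -/
def revStar (n : ℕ) (P : Polynomial ℂ) : Polynomial ℂ :=
  ∑ j ∈ Finset.range (n + 1),
    Polynomial.C ((starRingEnd ℂ) (P.coeff (n - j))) * Polynomial.X ^ j

/-- The Bernstein–Szegő measure `dθ/(2π |Q(e^{iθ})|²)` as a measure on `ℂ`. -/
def bsMeasure (Q : Polynomial ℂ) : Measure ℂ :=
  Measure.map (fun θ : ℝ => Complex.exp (Complex.I * θ))
    ((volume.restrict (Set.Ioc 0 (2 * Real.pi))).withDensity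
      (fun θ => ENNReal.ofReal ((2 * Real.pi * ‖Q.eval (Complex.exp (Complex.I * θ))‖ ^ 2)⁻¹)))

open scoped ComplexConjugate

/-! ### The reversed polynomial -/

lemma coeff_revStar (n : ℕ) (P : ℂ[X]) (j : ℕ) :
    (revStar n P).coeff j = if j ≤ n then conj (P.coeff (n - j)) else 0 := by
  simp only [revStar, finsetSum_coeff, coeff_C_mul, coeff_X_pow, mul_ite, mul_one, mul_zero]
  simp [Finset.sum_ite_eq]

lemma natDegree_revStar_le (n : ℕ) (P : ℂ[X]) : (revStar n P).natDegree ≤ n := by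
  rw [natDegree_le_iff_coeff_eq_zero]
  intro j hj
  rw [coeff_revStar, if_neg (by lia)]

lemma revStar_C_mul (n : ℕ) (c : ℂ) (P : ℂ[X]) :
    revStar n (C c * P) = C (conj c) * revStar n P := by
  ext j
  simp only [coeff_revStar, coeff_C_mul]
  split_ifs <;> simp

lemma revStar_one_zero : revStar 0 1 = 1 := by
  simp [revStar]

lemma eval_revStar_zero {n : ℕ} {P : ℂ[X]} (hP : P.Monic) (hn : P.natDegree = n) :
    (revStar n P).eval 0 = 1 := by
  have h : P.coeff n = 1 := by rw [← hn]; exact hP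
  rw [← coeff_zero_eq_eval_zero, coeff_revStar]
  simp [h]

/-- The reversed form of the Szegő recursion. -/
lemma revStar_X_mul_add {n : ℕ} {P : ℂ[X]} (hP : P.natDegree ≤ n) (a : ℂ) :
    revStar (n + 1) (X * P + C a * revStar n P) = revStar n P + C (conj a) * (X * P) := by
  ext j
  simp only [coeff_revStar, coeff_add, coeff_C_mul]
  rcases j with _ | j
  · simp
  · by_cases hj : j ≤ n
    · rw [if_pos (by lia), Nat.add_sub_add_right, if_pos (by lia), coeff_X_mul,
        Nat.sub_sub_self hj]
      rcases hj.eq_or_lt with rfl | hlt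
      · simp
      · obtain ⟨k, rfl⟩ : ∃ k, n = j + 1 + k := ⟨n - (j + 1), by lia⟩
        have h : j + 1 + k - j = k + 1 := by lia
        rw [h, coeff_X_mul, if_pos (by lia)]
        simp
    · rw [if_neg (by lia), if_neg (by lia), coeff_X_mul, coeff_eq_zero_of_natDegree_lt (by lia)]
      simp

lemma eval_revStar_of_norm_eq_one {n : ℕ} {P : ℂ[X]} (hP : P.natDegree ≤ n) {w : ℂ}
    (hw : ‖w‖ = 1) : (revStar n P).eval w = w ^ n * conj (P.eval w) := by
  have h : w * conj w = 1 := by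
    rw [Complex.mul_conj, Complex.normSq_eq_norm_sq, hw]; simp
  rw [eval_eq_sum_range' (Nat.lt_succ_of_le hP), revStar, eval_finsetSum, map_sum,
    Finset.mul_sum, ← Finset.sum_range_reflect]
  refine Finset.sum_congr rfl fun j hj => ?_
  obtain ⟨k, rfl⟩ : ∃ k, n = j + k := ⟨n - j, by simp at hj; lia⟩
  have h₁ : j + k + 1 - 1 - j = k := by lia
  have h₂ : j + k - k = j := by lia
  simp only [h₁, h₂, eval_mul, eval_C, eval_pow, eval_X, map_mul, map_pow]
  calc conj (P.coeff j) * w ^ k = (w * conj w) ^ j * (conj (P.coeff j) * w ^ k) := by simp [h]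
    _ = _ := by ring

lemma norm_eval_revStar_of_norm_eq_one {n : ℕ} {P : ℂ[X]} (hP : P.natDegree ≤ n) {w : ℂ}
    (hw : ‖w‖ = 1) : ‖(revStar n P).eval w‖ = ‖P.eval w‖ := by
  simp [eval_revStar_of_norm_eq_one hP hw, hw]

/-! ### Polynomials in `L²(μ)` -/

namespace IsNontrivialOnCircle

variable {μ : Measure ℂ}

lemma ae_norm_eq_one (hμ : IsNontrivialOnCircle μ) : ∀ᵐ z ∂μ, ‖z‖ = 1 := hμ.onCircle

lemma integrable_of_continuous (hμ : IsNontrivialOnCircle μ) {f : ℂ → ℂ} (hf : Continuous f) :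
    Integrable f μ := by
  have := hμ.prob
  obtain ⟨M, hM⟩ := (isCompact_sphere (0 : ℂ) 1).exists_bound_of_continuousOn hf.continuousOn
  refine Integrable.of_bound hf.aestronglyMeasurable M ?_
  filter_upwards [hμ.ae_norm_eq_one] with z hz
  exact hM z (by simpa using hz)

lemma integrable_conj_mul (hμ : IsNontrivialOnCircle μ) (P Q : ℂ[X]) :
    Integrable (fun z => conj (P.eval z) * Q.eval z) μ :=
  hμ.integrable_of_continuous ((Complex.continuous_conj.comp P.continuous).mul Q.continuous)

lemma integrable_pow_mul (hμ : IsNontrivialOnCircle μ) (j : ℕ) (Q : ℂ[X]) :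
    Integrable (fun z => conj z ^ j * Q.eval z) μ :=
  hμ.integrable_of_continuous ((Complex.continuous_conj.pow j).mul Q.continuous)

lemma integrable_norm_sq (hμ : IsNontrivialOnCircle μ) (P : ℂ[X]) :
    Integrable (fun z => ‖P.eval z‖ ^ 2) μ := by
  refine (hμ.integrable_conj_mul P P).norm.congr (.of_forall fun z => ?_)
  simp [sq]

lemma integral_conj_mul_eq_zero (hμ : IsNontrivialOnCircle μ) {P Q : ℂ[X]}
    (h : ∀ j, P.coeff j ≠ 0 → ∫ z, conj z ^ j * Q.eval z ∂μ = 0) :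
    ∫ z, conj (P.eval z) * Q.eval z ∂μ = 0 := by
  have hP : ∀ z, conj (P.eval z) * Q.eval z
      = ∑ j ∈ P.support, conj (P.coeff j) * (conj z ^ j * Q.eval z) := by
    intro z
    rw [eval_eq_sum, Polynomial.sum, map_sum, Finset.sum_mul]
    simp [mul_assoc]
  simp_rw [hP]
  rw [integral_finsetSum _ fun j _ => (hμ.integrable_pow_mul j Q).const_mul _]
  refine Finset.sum_eq_zero fun j hj => ?_
  rw [integral_const_mul, h j (mem_support_iff.1 hj), mul_zero]

lemma integral_conj_mul_self (P : ℂ[X]) :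
    ∫ z, conj (P.eval z) * P.eval z ∂μ = (polyNormSq μ P : ℂ) := by
  rw [polyNormSq, ← integral_complex_ofReal]
  simp_rw [Complex.conj_mul', Complex.ofReal_pow]

lemma polyNormSq_pos (hμ : IsNontrivialOnCircle μ) {P : ℂ[X]} (hP : P ≠ 0) :
    0 < polyNormSq μ P := by
  refine (integral_nonneg fun z => by positivity).lt_of_ne' fun h => ?_
  rw [integral_eq_zero_iff_of_nonneg (fun z => by positivity) (hμ.integrable_norm_sq P)] at h
  refine hμ.infiniteSupport P.roots.toFinset (measure_mono_null ?_ h)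
  intro z hz
  simpa [hP] using hz

end IsNontrivialOnCircle

/-! ### The Szegő recursion -/

namespace IsMonicOPUC

variable {μ : Measure ℂ} {Φ : ℕ → ℂ[X]}

lemma zero_eq_one (hΦ : IsMonicOPUC μ Φ) : Φ 0 = 1 :=
  (hΦ 0).1.1.natDegree_eq_zero.1 (hΦ 0).1.2

lemma integral_revStar (hμ : IsNontrivialOnCircle μ) (hΦ : IsMonicOPUC μ Φ) {n j : ℕ}
    (hj : 1 ≤ j) (hjn : j ≤ n) :
    ∫ z, conj z ^ j * (revStar n (Φ n)).eval z ∂μ = 0 := by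
  have h := (hΦ n).2 (n - j) (by lia)
  have hc := congrArg conj h
  rw [← integral_conj, map_zero] at hc
  rw [← hc]
  refine integral_congr_ae ?_
  filter_upwards [hμ.ae_norm_eq_one] with z hz
  have hzz : conj z * z = 1 := by simp [Complex.conj_mul', hz]
  rw [eval_revStar_of_norm_eq_one (hΦ n).1.2.le hz]
  obtain ⟨k, rfl⟩ : ∃ k, n = j + k := ⟨n - j, by lia⟩
  simp only [Nat.add_sub_cancel_left, map_mul, map_pow, Complex.conj_conj]
  calc _ = (conj z * z) ^ j * (z ^ k * conj ((Φ (j + k)).eval z)) := by ring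
    _ = _ := by rw [hzz]; simp

lemma integral_X_mul (hμ : IsNontrivialOnCircle μ) (hΦ : IsMonicOPUC μ Φ) {n j : ℕ}
    (hj : 1 ≤ j) (hjn : j ≤ n) :
    ∫ z, conj z ^ j * (X * Φ n).eval z ∂μ = 0 := by
  rw [← (hΦ n).2 (j - 1) (by lia)]
  refine integral_congr_ae ?_
  filter_upwards [hμ.ae_norm_eq_one] with z hz
  have hzz : conj z * z = 1 := by simp [Complex.conj_mul', hz]
  obtain ⟨k, rfl⟩ : ∃ k, j = k + 1 := ⟨j - 1, by lia⟩
  simp only [eval_mul, eval_X, Nat.add_sub_cancel]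
  calc _ = (conj z * z) * (conj z ^ k * (Φ n).eval z) := by ring
    _ = _ := by rw [hzz, one_mul]

/-- The Szegő recursion `Φ_{n+1} = z Φ_n + Φ_{n+1}(0) Φ_n^*`. -/
lemma szego (hμ : IsNontrivialOnCircle μ) (hΦ : IsMonicOPUC μ Φ) (n : ℕ) :
    Φ (n + 1) = X * Φ n + C ((Φ (n + 1)).eval 0) * revStar n (Φ n) := by
  set a := (Φ (n + 1)).eval 0 with ha
  set R := Φ (n + 1) - (X * Φ n + C a * revStar n (Φ n)) with hR
  have hcoeff : ∀ j, R.coeff j ≠ 0 → 1 ≤ j ∧ j ≤ n := by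
    intro j
    contrapose!
    intro hj
    rcases Nat.eq_zero_or_pos j with rfl | hpos
    · rw [coeff_zero_eq_eval_zero]
      simp [hR, eval_revStar_zero (hΦ n).1.1 (hΦ n).1.2, ha]
    · obtain ⟨k, rfl⟩ : ∃ k, j = k + 1 := ⟨j - 1, by lia⟩
      have hk := hj hpos
      have hs : (revStar n (Φ n)).coeff (k + 1) = 0 := by
        rw [coeff_revStar, if_neg (by lia)]
      rw [hR, coeff_sub, coeff_add, coeff_X_mul, coeff_C_mul, hs]
      rcases (show n ≤ k by lia).eq_or_lt with rfl | hlt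
      · have h₁ : (Φ (n + 1)).coeff (n + 1) = 1 := by
          simpa [leadingCoeff, (hΦ (n + 1)).1.2] using (hΦ (n + 1)).1.1.leadingCoeff
        have h₂ : (Φ n).coeff n = 1 := by
          simpa [leadingCoeff, (hΦ n).1.2] using (hΦ n).1.1.leadingCoeff
        simp [h₁, h₂]
      · rw [coeff_eq_zero_of_natDegree_lt (by rw [(hΦ _).1.2]; lia),
          coeff_eq_zero_of_natDegree_lt (by rw [(hΦ _).1.2]; lia)]
        simp
  have horth : ∀ j, R.coeff j ≠ 0 → ∫ z, conj z ^ j * R.eval z ∂μ = 0 := by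
    intro j hj
    obtain ⟨h₁, h₂⟩ := hcoeff j hj
    have hsplit : ∀ z, conj z ^ j * R.eval z = conj z ^ j * (Φ (n + 1)).eval z
        - (conj z ^ j * (X * Φ n).eval z + a * (conj z ^ j * (revStar n (Φ n)).eval z)) := by
      intro z
      simp only [hR, eval_sub, eval_add, eval_mul, eval_C]
      ring
    simp_rw [hsplit]
    have hi := (hμ.integrable_pow_mul j (revStar n (Φ n))).const_mul a
    have hi' : Integrable (fun z => conj z ^ j * (X * Φ n).eval z
        + a * (conj z ^ j * (revStar n (Φ n)).eval z)) μ := (hμ.integrable_pow_mul j _).add hi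
    rw [integral_sub (hμ.integrable_pow_mul _ _) hi',
      integral_add (hμ.integrable_pow_mul _ _) hi,
      integral_const_mul, hΦ.integral_X_mul hμ h₁ h₂, hΦ.integral_revStar hμ h₁ h₂,
      (hΦ (n + 1)).2 j (by lia)]
    simp
  have hzero := hμ.integral_conj_mul_eq_zero horth
  rw [IsNontrivialOnCircle.integral_conj_mul_self, Complex.ofReal_eq_zero] at hzero
  have hR0 : R = 0 := by
    by_contra hne
    exact (hμ.polyNormSq_pos hne).ne' hzero
  exact sub_eq_zero.1 hR0

lemma revStar_szego (hμ : IsNontrivialOnCircle μ) (hΦ : IsMonicOPUC μ Φ) (n : ℕ) :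
    revStar (n + 1) (Φ (n + 1))
      = revStar n (Φ n) + C (conj ((Φ (n + 1)).eval 0)) * (X * Φ n) := by
  conv_lhs => rw [hΦ.szego hμ n]
  exact revStar_X_mul_add (hΦ n).1.2.le _

lemma polyNormSq_pos (hμ : IsNontrivialOnCircle μ) (hΦ : IsMonicOPUC μ Φ) (n : ℕ) :
    0 < polyNormSq μ (Φ n) :=
  hμ.polyNormSq_pos (hΦ n).1.1.ne_zero

lemma polyNormSq_zero (hμ : IsNontrivialOnCircle μ) (hΦ : IsMonicOPUC μ Φ) :
    polyNormSq μ (Φ 0) = 1 := by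
  have := hμ.prob
  simp [polyNormSq, hΦ.zero_eq_one]

lemma polyNormSq_succ (hμ : IsNontrivialOnCircle μ) (hΦ : IsMonicOPUC μ Φ) (n : ℕ) :
    polyNormSq μ (Φ (n + 1)) = (1 - ‖(Φ (n + 1)).eval 0‖ ^ 2) * polyNormSq μ (Φ n) := by
  set a := (Φ (n + 1)).eval 0 with ha
  have horth : ∫ z, conj ((revStar n (Φ n)).eval z) * (Φ (n + 1)).eval z ∂μ = 0 := by
    refine hμ.integral_conj_mul_eq_zero fun j hj => (hΦ (n + 1)).2 j ?_
    have := (le_natDegree_of_ne_zero hj).trans (natDegree_revStar_le _ _)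
    lia
  have hint := hμ.integrable_conj_mul (revStar n (Φ n)) (Φ (n + 1))
  have hre : ∫ z, (conj a * (conj ((revStar n (Φ n)).eval z) * (Φ (n + 1)).eval z)).re ∂μ = 0 := by
    have h := integral_re (hint.const_mul (conj a))
    rw [integral_const_mul, horth, mul_zero, map_zero] at h
    exact h
  have hpt : ∀ᵐ z ∂μ, ‖(Φ (n + 1)).eval z‖ ^ 2 = (1 - ‖a‖ ^ 2) * ‖(Φ n).eval z‖ ^ 2
      + 2 * (conj a * (conj ((revStar n (Φ n)).eval z) * (Φ (n + 1)).eval z)).re := by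
    filter_upwards [hμ.ae_norm_eq_one] with z hz
    have hs := congrArg (eval z) (hΦ.szego hμ n)
    simp only [eval_add, eval_mul, eval_X, eval_C, ← ha] at hs
    have hnorm := norm_eval_revStar_of_norm_eq_one (hΦ n).1.2.le hz
    have h₁ : ‖(Φ (n + 1)).eval z - a * (revStar n (Φ n)).eval z‖ ^ 2 = ‖(Φ n).eval z‖ ^ 2 := by
      rw [hs]; simp [hz]
    rw [← Complex.normSq_eq_norm_sq, Complex.normSq_sub, Complex.normSq_mul,
      Complex.normSq_eq_norm_sq, Complex.normSq_eq_norm_sq, Complex.normSq_eq_norm_sq,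
      hnorm, map_mul] at h₁
    have h₂ : (Φ (n + 1)).eval z * (conj a * conj ((revStar n (Φ n)).eval z))
      = conj a * (conj ((revStar n (Φ n)).eval z) * (Φ (n + 1)).eval z) := by ring
    rw [h₂] at h₁
    linarith
  have hint' : Integrable (fun z =>
      2 * (conj a * (conj ((revStar n (Φ n)).eval z) * (Φ (n + 1)).eval z)).re) μ :=
    (hint.const_mul (conj a)).re.const_mul 2
  rw [polyNormSq, integral_congr_ae hpt, integral_add ((hμ.integrable_norm_sq _).const_mul _)
    hint', integral_const_mul, integral_const_mul, hre]
  simp [polyNormSq]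

lemma norm_eval_zero_lt_one (hμ : IsNontrivialOnCircle μ) (hΦ : IsMonicOPUC μ Φ) (n : ℕ) :
    ‖(Φ (n + 1)).eval 0‖ < 1 := by
  have h := hΦ.polyNormSq_pos hμ (n + 1)
  rw [hΦ.polyNormSq_succ hμ] at h
  have := pos_of_mul_pos_left h (hΦ.polyNormSq_pos hμ n).le
  nlinarith [norm_nonneg ((Φ (n + 1)).eval 0)]

/-- `Φ_n^*` has no zeros in the closed disk, and dominates `Φ_n` there. -/
lemma revStar_ne_zero_and_norm_le (hμ : IsNontrivialOnCircle μ) (hΦ : IsMonicOPUC μ Φ) (n : ℕ)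
    {z : ℂ} (hz : ‖z‖ ≤ 1) :
    (revStar n (Φ n)).eval z ≠ 0 ∧ ‖(Φ n).eval z‖ ≤ ‖(revStar n (Φ n)).eval z‖ := by
  induction n with
  | zero => simp [hΦ.zero_eq_one, revStar_one_zero]
  | succ n ih =>
    obtain ⟨hne, hle⟩ := ih
    have ha := hΦ.norm_eval_zero_lt_one hμ n
    have h₁ := congrArg (eval z) (hΦ.szego hμ n)
    have h₂ := congrArg (eval z) (hΦ.revStar_szego hμ n)
    simp only [eval_add, eval_mul, eval_X, eval_C] at h₁ h₂
    rw [h₂]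
    rw [h₁]
    generalize (Φ (n + 1)).eval 0 = a at *
    generalize (revStar n (Φ n)).eval z = b at *
    have hzb : ‖z * (Φ n).eval z‖ ≤ ‖b‖ := by
      rw [norm_mul]
      exact (mul_le_of_le_one_left (norm_nonneg _) hz).trans hle
    generalize z * (Φ n).eval z = p at *
    constructor
    · intro h
      have h₃ : ‖b‖ = ‖a‖ * ‖p‖ := by
        rw [eq_neg_of_add_eq_zero_left h]; simp
      have := norm_pos_iff.2 hne
      nlinarith [norm_nonneg a]
    · refine le_of_sq_le_sq ?_ (norm_nonneg _)
      have h₃ : ‖b + conj a * p‖ ^ 2 - ‖p + a * b‖ ^ 2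
          = (1 - ‖a‖ ^ 2) * (‖b‖ ^ 2 - ‖p‖ ^ 2) := by
        simp only [← Complex.normSq_eq_norm_sq, Complex.normSq_apply, Complex.add_re,
          Complex.add_im, Complex.mul_re, Complex.mul_im, Complex.conj_re, Complex.conj_im]
        ring
      have h₄ : 0 ≤ 1 - ‖a‖ ^ 2 := by nlinarith [norm_nonneg a]
      have h₅ : 0 ≤ ‖b‖ ^ 2 - ‖p‖ ^ 2 := by nlinarith [norm_nonneg p]
      nlinarith [mul_nonneg h₄ h₅]

variable {ν : Measure ℂ} {Ψ : ℕ → ℂ[X]}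

/-- The second kind polynomials have the same norms as the first kind ones. -/
lemma polyNormSq_eq (hμ : IsNontrivialOnCircle μ) (hν : IsNontrivialOnCircle ν)
    (hΦ : IsMonicOPUC μ Φ) (hΨ : IsMonicOPUC ν Ψ)
    (h : ∀ m, (Ψ (m + 1)).eval 0 = -(Φ (m + 1)).eval 0) (n : ℕ) :
    polyNormSq ν (Ψ n) = polyNormSq μ (Φ n) := by
  induction n with
  | zero => rw [hΦ.polyNormSq_zero hμ, hΨ.polyNormSq_zero hν]
  | succ n ih => rw [hΦ.polyNormSq_succ hμ, hΨ.polyNormSq_succ hν, ih, h, norm_neg]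

/-- The Wronskian-type identity `Ψ_n^* Φ_n + Φ_n^* Ψ_n = 2 ‖Φ_n‖² z^n`. -/
lemma revStar_mul_add (hμ : IsNontrivialOnCircle μ) (hν : IsNontrivialOnCircle ν)
    (hΦ : IsMonicOPUC μ Φ) (hΨ : IsMonicOPUC ν Ψ)
    (h : ∀ m, (Ψ (m + 1)).eval 0 = -(Φ (m + 1)).eval 0) (n : ℕ) (z : ℂ) :
    (revStar n (Ψ n)).eval z * (Φ n).eval z + (revStar n (Φ n)).eval z * (Ψ n).eval z
      = 2 * polyNormSq μ (Φ n) * z ^ n := by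
  induction n with
  | zero =>
    rw [hΦ.polyNormSq_zero hμ, hΦ.zero_eq_one, hΨ.zero_eq_one, revStar_one_zero]
    simp; norm_num
  | succ n ih =>
    rw [hΦ.polyNormSq_succ hμ, hΦ.revStar_szego hμ, hΨ.revStar_szego hν]
    have h₁ := congrArg (eval z) (hΦ.szego hμ n)
    have h₂ := congrArg (eval z) (hΨ.szego hν n)
    rw [h₁, h₂, h]
    have ha : conj ((Φ (n + 1)).eval 0) * (Φ (n + 1)).eval 0
        = (‖(Φ (n + 1)).eval 0‖ : ℂ) ^ 2 := Complex.conj_mul' _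
    simp only [eval_add, eval_mul, eval_X, eval_C, eval_neg, map_neg]
    push_cast
    rw [← ha]
    linear_combination
      (1 - conj ((Φ (n + 1)).eval 0) * (Φ (n + 1)).eval 0) * z * ih

end IsMonicOPUC

/-! ### The Schwarz integral formula and the Bernstein–Szegő measure -/

/-- The complex Schwarz (Herglotz) formula on the unit disk. -/
lemma DiffContOnCl.circleAverage_herglotz {G : ℂ → ℂ} (hG : DiffContOnCl ℂ G (Metric.ball 0 1))
    {z : ℂ} (hz : z ∈ Metric.ball (0 : ℂ) 1) :
    Real.circleAverage (fun w => (w + z) / (w - z) * (G w + conj (G w))) 0 1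
      = 2 * G z - G 0 + conj (G 0) := by
  have hz1 : ‖z‖ < 1 := by simpa using hz
  have key : ∀ {H : ℂ → ℂ} {u : ℂ}, DiffContOnCl ℂ H (Metric.ball 0 1) →
      u ∈ Metric.ball (0 : ℂ) 1 → Real.circleAverage (fun w => w / (w - u) * H w) 0 1 = H u := by
    intro H u hH hu
    have := DiffContOnCl.circleAverage_smul_div (c := 0) (R := 1) (w := u) (f := H)
      (by simpa using hH) (by simpa using hu)
    simpa using this
  have hsub : ∀ w ∈ Metric.sphere (0 : ℂ) |1|, w - z ≠ 0 := by
    rintro w hw h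
    rw [sub_eq_zero] at h
    simp [h] at hw
    linarith
  have hcont : ContinuousOn G (Metric.sphere (0 : ℂ) |1|) := by
    refine hG.continuousOn.mono ?_
    rw [closure_ball _ one_ne_zero, abs_one]
    exact Metric.sphere_subset_closedBall
  have hcont' : ContinuousOn (fun w => conj (G w)) (Metric.sphere (0 : ℂ) |1|) :=
    Complex.continuous_conj.comp_continuousOn hcont
  have hk : ContinuousOn (fun w => w / (w - z)) (Metric.sphere (0 : ℂ) |1|) :=
    continuousOn_id.div (continuousOn_id.sub continuousOn_const) hsub
  have hk' : ContinuousOn (fun w => (w + z) / (w - z)) (Metric.sphere (0 : ℂ) |1|) :=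
    (continuousOn_id.add continuousOn_const).div (continuousOn_id.sub continuousOn_const) hsub
  have h0 : (0 : ℂ) ∈ Metric.ball (0 : ℂ) 1 := by simp
  have havg : Real.circleAverage G 0 1 = G 0 :=
    DiffContOnCl.circleAverage (by simpa using hG)
  -- the holomorphic part
  have h₁ : Real.circleAverage (fun w => (w + z) / (w - z) * G w) 0 1 = 2 * G z - G 0 := by
    have e : Set.EqOn (fun w => (w + z) / (w - z) * G w)
        (fun w => (2 : ℂ) • (w / (w - z) * G w) - G w) (Metric.sphere (0 : ℂ) |1|) := by
      intro w hw
      have := hsub w hw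
      simp only [smul_eq_mul]
      field_simp
      ring
    have hi : CircleIntegrable (fun w => (2 : ℂ) • (w / (w - z) * G w)) 0 1 :=
      ((hk.mul hcont).const_smul (2 : ℂ)).circleIntegrable'
    rw [Real.circleAverage_congr_sphere e,
      Real.circleAverage_fun_sub hi hcont.circleIntegrable',
      Real.circleAverage_fun_smul, key hG hz, havg, smul_eq_mul]
  -- the antiholomorphic part
  have hden : ∀ w ∈ Metric.closedBall (0 : ℂ) 1, 1 - conj z * w ≠ 0 := by
    intro w hw h
    have hw1 : ‖w‖ ≤ 1 := by simpa using hw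
    have : ‖conj z * w‖ = 1 := by rw [← sub_eq_zero.1 h]; simp
    rw [norm_mul, RCLike.norm_conj] at this
    nlinarith [norm_nonneg z, norm_nonneg w]
  have h₂ : Real.circleAverage (fun w => (w + z) / (w - z) * conj (G w)) 0 1 = conj (G 0) := by
    set H : ℂ → ℂ := fun w => (1 + conj z * w) / (1 - conj z * w) * G w with hH
    have hHd : DiffContOnCl ℂ H (Metric.ball 0 1) := by
      have hq : DiffContOnCl ℂ (fun w => (1 + conj z * w) / (1 - conj z * w))
          (Metric.ball 0 1) := by
        apply DifferentiableOn.diffContOnCl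
        rw [closure_ball _ one_ne_zero]
        exact DifferentiableOn.div (by fun_prop) (by fun_prop) hden
      exact hq.smul hG
    have hHavg : Real.circleAverage H 0 1 = H 0 :=
      DiffContOnCl.circleAverage (by simpa using hHd)
    have hHc : ContinuousOn H (Metric.sphere (0 : ℂ) |1|) := by
      refine hHd.continuousOn.mono ?_
      rw [closure_ball _ one_ne_zero, abs_one]
      exact Metric.sphere_subset_closedBall
    have hconj := ContinuousLinearMap.circleAverage_comp_comm
      (Complex.conjCLE : ℂ →L[ℝ] ℂ) (hHc.circleIntegrable')
    have e : Set.EqOn (fun w => (w + z) / (w - z) * conj (G w))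
        ((Complex.conjCLE : ℂ →L[ℝ] ℂ) ∘ H) (Metric.sphere (0 : ℂ) |1|) := by
      intro w hw
      have hw1 : ‖w‖ = 1 := by simpa using hw
      have hww : w * conj w = 1 := by simp [Complex.mul_conj', hw1]
      have hne := hsub w hw
      have hne' : 1 - z * conj w ≠ 0 := by
        intro h
        apply hne
        linear_combination w * h + z * hww
      have : (w + z) / (w - z) = (1 + z * conj w) / (1 - z * conj w) := by
        rw [div_eq_div_iff hne hne']
        linear_combination (-2 * z) * hww
      simp [hH, this]
    rw [Real.circleAverage_congr_sphere e, hconj, hHavg]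
    simp [hH]
  simp_rw [mul_add]
  have hi : CircleIntegrable (fun w => (w + z) / (w - z) * G w) 0 1 :=
    (hk'.mul hcont).circleIntegrable'
  have hi' : CircleIntegrable (fun w => (w + z) / (w - z) * conj (G w)) 0 1 :=
    (hk'.mul hcont').circleIntegrable'
  rw [Real.circleAverage_fun_add hi hi', h₁, h₂]

lemma integral_bsMeasure (Q : ℂ[X]) {f : ℂ → ℂ} (hf : Measurable f) :
    ∫ w, f w ∂(bsMeasure Q)
      = Real.circleAverage (fun w => f w * ((‖Q.eval w‖ ^ 2)⁻¹ : ℝ)) 0 1 := by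
  have he : Measurable fun θ : ℝ => Complex.exp (Complex.I * θ) := by fun_prop
  have hQ : Measurable fun w : ℂ => Q.eval w := Q.continuous.measurable
  have hd : Measurable fun θ : ℝ =>
      ENNReal.ofReal ((2 * Real.pi * ‖Q.eval (Complex.exp (Complex.I * θ))‖ ^ 2)⁻¹) :=
    ((((hQ.comp he).norm.pow_const 2).const_mul _).inv).ennreal_ofReal
  rw [bsMeasure, integral_map he.aemeasurable hf.aestronglyMeasurable,
    integral_withDensity_eq_integral_toReal_smul hd (.of_forall fun _ => ENNReal.ofReal_lt_top),
    Real.circleAverage_def, intervalIntegral.integral_of_le (by positivity), ← integral_smul]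
  refine integral_congr_ae (.of_forall fun θ => ?_)
  have hc : circleMap 0 1 θ = Complex.exp (Complex.I * θ) := by simp [circleMap, mul_comm]
  simp only [hc]
  rw [ENNReal.toReal_ofReal (by positivity)]
  simp only [Complex.real_smul]
  push_cast
  rw [mul_inv]
  ring


/-- Verblunsky: the Carathéodory function of the Bernstein–Szegő measure
`dμ_n = dθ/(2π|φ_n(e^{iθ})|²)` is `ψ_n^*(z)/φ_n^*(z)` on `𝔻`, where `ψ_n` are the
second kind polynomials of `μ`. -/
theorem stmt13 (μ ν : Measure ℂ) (hμ : IsNontrivialOnCircle μ) (hν : IsNontrivialOnCircle ν)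
    (Φ Ψ : ℕ → Polynomial ℂ) (hΦ : IsMonicOPUC μ Φ) (hΨ : IsMonicOPUC ν Ψ)
    (hsecond : ∀ m, verblunsky Ψ m = - verblunsky Φ m) (n : ℕ) :
    ∀ z ∈ Metric.ball (0:ℂ) 1,
      (∫ w, (w + z) / (w - z) ∂(bsMeasure (orthonormalize μ (Φ n))))
        = (revStar n (orthonormalize ν (Ψ n))).eval z
            / (revStar n (orthonormalize μ (Φ n))).eval z := by
  intro z hz
  have h0 : ∀ m, (Ψ (m + 1)).eval 0 = -(Φ (m + 1)).eval 0 := by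
    intro m
    have h := congrArg conj (hsecond m)
    simp only [verblunsky, map_neg, Complex.conj_conj] at h
    linear_combination -h
  have hN := hΦ.polyNormSq_pos hμ n
  have hNeq := hΦ.polyNormSq_eq hμ hν hΨ h0 n
  have hW := hΦ.revStar_mul_add hμ hν hΨ h0 n
  set N := polyNormSq μ (Φ n) with hNdef
  have hcne : ((Real.sqrt N : ℂ))⁻¹ ≠ 0 := by
    simpa using (Real.sqrt_pos.2 hN).ne'
  set G : ℂ → ℂ := fun w => (revStar n (Ψ n)).eval w / (revStar n (Φ n)).eval w with hG
  have hGd : DiffContOnCl ℂ G (Metric.ball 0 1) := by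
    apply DifferentiableOn.diffContOnCl
    rw [closure_ball _ one_ne_zero]
    refine (Polynomial.differentiable _).differentiableOn.div
      (Polynomial.differentiable _).differentiableOn fun w hw => ?_
    exact (hΦ.revStar_ne_zero_and_norm_le hμ n (by simpa using hw)).1
  have hG0 : G 0 = 1 := by
    simp [hG, eval_revStar_zero (hΦ n).1.1 (hΦ n).1.2, eval_revStar_zero (hΨ n).1.1 (hΨ n).1.2]
  have hrhs : (revStar n (orthonormalize ν (Ψ n))).eval z
      / (revStar n (orthonormalize μ (Φ n))).eval z = G z := by
    rw [orthonormalize, orthonormalize, hNeq, ← hNdef, revStar_C_mul, revStar_C_mul, eval_mul,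
      eval_mul, eval_C, mul_div_mul_left _ _ ((_root_.map_ne_zero _).2 hcne)]
  have hcongr : Set.EqOn
      (fun w => (w + z) / (w - z) * ((‖(orthonormalize μ (Φ n)).eval w‖ ^ 2)⁻¹ : ℝ))
      (fun w => (2⁻¹ : ℂ) • ((w + z) / (w - z) * (G w + conj (G w))))
      (Metric.sphere (0 : ℂ) |1|) := by
    intro w hw
    have hw1 : ‖w‖ = 1 := by simpa using hw
    have hww : w * conj w = 1 := by simp [Complex.mul_conj', hw1]
    have hw0 : w ≠ 0 := by rintro rfl; simp at hw1
    have hs := (hΦ.revStar_ne_zero_and_norm_le hμ n hw1.le).1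
    have h₁ := eval_revStar_of_norm_eq_one (hΦ n).1.2.le hw1
    have h₂ := eval_revStar_of_norm_eq_one (hΨ n).1.2.le hw1
    have hp : conj ((Φ n).eval w) ≠ 0 := by
      intro h; rw [h, mul_zero] at h₁; exact hs h₁
    have hp' : (Φ n).eval w ≠ 0 := by simpa using hp
    have hWw := hW w
    rw [h₁, h₂] at hWw
    have hW' : conj ((Ψ n).eval w) * (Φ n).eval w + conj ((Φ n).eval w) * (Ψ n).eval w
        = 2 * N := by
      apply mul_left_cancel₀ (pow_ne_zero n hw0)
      linear_combination hWw
    have hnorm : (((‖(orthonormalize μ (Φ n)).eval w‖ ^ 2)⁻¹ : ℝ) : ℂ)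
        = N / (conj ((Φ n).eval w) * (Φ n).eval w) := by
      rw [Complex.conj_mul', orthonormalize, eval_mul, eval_C, ← hNdef, norm_mul, norm_inv,
        Complex.norm_real, Real.norm_of_nonneg (Real.sqrt_nonneg _), mul_pow, inv_pow,
        Real.sq_sqrt hN.le, mul_inv, inv_inv, div_eq_mul_inv]
      push_cast
      ring
    have hGw : G w = conj ((Ψ n).eval w) / conj ((Φ n).eval w) := by
      simp only [hG]
      rw [h₁, h₂, mul_div_mul_left _ _ (pow_ne_zero n hw0)]
    have hsum : G w + conj (G w) = 2 * (N / (conj ((Φ n).eval w) * (Φ n).eval w)) := by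
      rw [hGw, map_div₀, Complex.conj_conj, Complex.conj_conj, div_add_div _ _ hp hp', hW',
        mul_div_assoc]
    simp only [smul_eq_mul]
    rw [hnorm, hsum]
    ring
  rw [hrhs, integral_bsMeasure _ (by fun_prop), Real.circleAverage_congr_sphere hcongr,
    Real.circleAverage_fun_smul, hGd.circleAverage_herglotz hz, hG0]
  simp

end
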